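/- Let r_1,…,r_m and c_1,…,c_n be positive integers with Σ_i r_i = Σ_j c_j = N, let W=(w_ij) be an m×n matrix of strictly positive reals, and let A(γ) be the associated block matrix. Define S(γ) = exp( inf_{t∈H} f_{A(γ)}(t) ), where f_A(t) = Σ_{p=1}^N ln(Σ_{q=1}^N a_pq e^{τ_q}) and H = {t : Σ τ_i = 0}. Let δ > 0 and let γ=(γ_ij), γ'=(γ'_ij) be m×n matrices with γ_ij ≥ δ and γ'_ij ≥ δ for all i,j. Then |ln S(γ) − ln S(γ')| ≤ (N/δ)·max_{ij} |γ_ij − γ'_ij|. -/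

import Mathlib

section LogScaling

variable {ι : Type*} [Fintype ι]

/-- On the hyperplane `∑ t = 0`, the row log-sum-exp functional of a positive matrix is bounded
below by the sum of the logarithms of the diagonal entries. -/
theorem sum_log_diag_le_sum_log_sum_mul_exp {a : ι → ι → ℝ} (ha : ∀ p q, 0 < a p q)
    {t : ι → ℝ} (ht : ∑ p, t p = 0) :
    ∑ p, Real.log (a p p) ≤ ∑ p, Real.log (∑ q, a p q * Real.exp (t q)) := by
  calc ∑ p, Real.log (a p p) = ∑ p, Real.log (a p p * Real.exp (t p)) := by
        simp [Real.log_mul (ha _ _).ne' (Real.exp_pos _).ne', Finset.sum_add_distrib, ht]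
    _ ≤ _ := Finset.sum_le_sum fun p _ =>
        Real.log_le_log (mul_pos (ha p p) (Real.exp_pos _))
          (Finset.single_le_sum (f := fun q => a p q * Real.exp (t q))
            (fun q _ => (mul_pos (ha p q) (Real.exp_pos _)).le) (Finset.mem_univ p))

theorem bddBelow_range_sum_log_sum_mul_exp {a : ι → ι → ℝ} (ha : ∀ p q, 0 < a p q) :
    BddBelow (Set.range fun t : {t : ι → ℝ // ∑ i, t i = 0} =>
      ∑ p, Real.log (∑ q, a p q * Real.exp (t.1 q))) := by
  refine ⟨∑ p, Real.log (a p p), ?_⟩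
  rintro _ ⟨t, rfl⟩
  exact sum_log_diag_le_sum_log_sum_mul_exp ha t.2

theorem sum_log_sum_mul_exp_le_add {a b : ι → ι → ℝ} (ha : ∀ p q, 0 < a p q)
    (hb : ∀ p q, 0 < b p q) {ε : ℝ} (hε : 0 ≤ ε) (hab : ∀ p q, a p q ≤ (1 + ε) * b p q)
    (t : ι → ℝ) :
    ∑ p, Real.log (∑ q, a p q * Real.exp (t q)) ≤
      ∑ p, Real.log (∑ q, b p q * Real.exp (t q)) + Fintype.card ι * ε := by
  have hsum : ∑ _p : ι, ε = Fintype.card ι * ε := by simp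
  rw [← hsum, ← Finset.sum_add_distrib]
  refine Finset.sum_le_sum fun p _ => ?_
  have hpos : ∀ {d : ι → ι → ℝ}, (∀ p q, 0 < d p q) → 0 < ∑ q, d p q * Real.exp (t q) :=
    fun hd => Finset.sum_pos (fun q _ => mul_pos (hd p q) (Real.exp_pos _)) ⟨p, Finset.mem_univ p⟩
  have hle : ∑ q, a p q * Real.exp (t q) ≤ (1 + ε) * ∑ q, b p q * Real.exp (t q) := by
    rw [Finset.mul_sum]
    refine Finset.sum_le_sum fun q _ => ?_
    rw [← mul_assoc]
    exact mul_le_mul_of_nonneg_right (hab p q) (Real.exp_pos _).le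
  have hlog := Real.log_le_log (hpos ha) hle
  rw [Real.log_mul (by positivity) (hpos hb).ne'] at hlog
  linarith [Real.log_le_sub_one_of_pos (show 0 < 1 + ε by positivity)]

theorem iInf_sum_log_sum_mul_exp_le_add {a b : ι → ι → ℝ} (ha : ∀ p q, 0 < a p q)
    (hb : ∀ p q, 0 < b p q) {ε : ℝ} (hε : 0 ≤ ε) (hab : ∀ p q, a p q ≤ (1 + ε) * b p q) :
    (⨅ t : {t : ι → ℝ // ∑ i, t i = 0}, ∑ p, Real.log (∑ q, a p q * Real.exp (t.1 q))) ≤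
      (⨅ t : {t : ι → ℝ // ∑ i, t i = 0}, ∑ p, Real.log (∑ q, b p q * Real.exp (t.1 q)))
        + Fintype.card ι * ε := by
  have : Nonempty {t : ι → ℝ // ∑ i, t i = 0} := ⟨⟨0, by simp⟩⟩
  rw [← sub_le_iff_le_add]
  refine le_ciInf fun t => ?_
  rw [sub_le_iff_le_add]
  exact (ciInf_le (bddBelow_range_sum_log_sum_mul_exp ha) t).trans
    (sum_log_sum_mul_exp_le_add ha hb hε hab t.1)

end LogScaling

theorem mul_le_one_add_div_mul_mul {w x y δ M : ℝ} (hw : 0 ≤ w) (hδ : 0 < δ) (hy : δ ≤ y)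
    (hxy : |x - y| ≤ M) : w * x ≤ (1 + M / δ) * (w * y) := by
  have hM : 0 ≤ M := (abs_nonneg _).trans hxy
  have hMy : M ≤ M / δ * y := by
    rw [div_mul_eq_mul_div, le_div_iff₀ hδ]
    exact mul_le_mul_of_nonneg_left hy hM
  have hx : x ≤ (1 + M / δ) * y := by linarith [(abs_le.mp hxy).2]
  linarith [mul_le_mul_of_nonneg_left hx hw]

/-- Lemma 4.4. With `ln S(γ) = inf_{t ∈ H} f_{A(γ)}(t)` where
`f_A(t) = Σ_p ln(Σ_q a_pq e^{τ_q})` and `H = {t : Σ τ_i = 0}`, if all entries of `γ, γ'`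
are at least `δ > 0`, then `|ln S(γ) − ln S(γ')| ≤ (N/δ) · max_{ij} |γ_ij − γ'_ij|`. -/
theorem log_S_lipschitz
    (m n N : ℕ) (hm : 0 < m) (hn : 0 < n)
    (r : Fin m → ℕ) (c : Fin n → ℕ)
    (hr : ∀ i, 0 < r i) (hc : ∀ j, 0 < c j)
    (hrN : ∑ i, r i = N) (hcN : ∑ j, c j = N)
    (W : Fin m → Fin n → ℝ) (hW : ∀ i j, 0 < W i j)
    (ρ : Fin N → Fin m) (κ : Fin N → Fin n)
    (hρ : ∀ i, Nat.card {p : Fin N // ρ p = i} = r i)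
    (hκ : ∀ j, Nat.card {q : Fin N // κ q = j} = c j)
    (δ : ℝ) (hδ : 0 < δ)
    (γ γ' : Fin m → Fin n → ℝ)
    (hγ : ∀ i j, δ ≤ γ i j) (hγ' : ∀ i j, δ ≤ γ' i j) :
    |(⨅ t : {t : Fin N → ℝ // ∑ i, t i = 0},
        ∑ p, Real.log (∑ q, W (ρ p) (κ q) * γ (ρ p) (κ q) * Real.exp (t.1 q)))
      - (⨅ t : {t : Fin N → ℝ // ∑ i, t i = 0},
        ∑ p, Real.log (∑ q, W (ρ p) (κ q) * γ' (ρ p) (κ q) * Real.exp (t.1 q)))|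
      ≤ ((N : ℝ) / δ) *
        Finset.univ.sup' ⟨(⟨0, hm⟩, ⟨0, hn⟩), Finset.mem_univ _⟩
          (fun p : Fin m × Fin n => |γ p.1 p.2 - γ' p.1 p.2|) := by
  set M := Finset.univ.sup' ⟨(⟨0, hm⟩, ⟨0, hn⟩), Finset.mem_univ _⟩
    (fun p : Fin m × Fin n => |γ p.1 p.2 - γ' p.1 p.2|)
  have hdiff : ∀ i j, |γ i j - γ' i j| ≤ M := fun i j =>
    Finset.le_sup' (fun p : Fin m × Fin n => |γ p.1 p.2 - γ' p.1 p.2|) (Finset.mem_univ (i, j))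
  have hε : 0 ≤ M / δ := div_nonneg ((abs_nonneg _).trans (hdiff ⟨0, hm⟩ ⟨0, hn⟩)) hδ.le
  have hpos : ∀ {g : Fin m → Fin n → ℝ}, (∀ i j, δ ≤ g i j) →
      ∀ p q : Fin N, 0 < W (ρ p) (κ q) * g (ρ p) (κ q) :=
    fun hg p q => mul_pos (hW _ _) (hδ.trans_le (hg _ _))
  have hle := iInf_sum_log_sum_mul_exp_le_add (hpos hγ) (hpos hγ') hε fun p q =>
    mul_le_one_add_div_mul_mul (hW _ _).le hδ (hγ' _ _) (hdiff _ _)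
  have hge := iInf_sum_log_sum_mul_exp_le_add (hpos hγ') (hpos hγ) hε fun p q =>
    mul_le_one_add_div_mul_mul (hW _ _).le hδ (hγ _ _)
      ((abs_sub_comm _ _).trans_le (hdiff _ _))
  rw [Fintype.card_fin] at hle hge
  rw [div_mul_eq_mul_div, ← mul_div_assoc']
  exact abs_sub_le_iff.mpr ⟨by linarith, by linarith⟩
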